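/- Let σ be the permutation of Fin 6 given by the 4-cycle (0 1 2 3), fixing 4 and 5. The number of monotone functions f : (Fin 6 → Bool) → Bool satisfying f(x ∘ σ) = f(x) for all x equals 494. In the paper's notation: |Fix((1234), D_6)| = 494. -/

import Mathlib

/-- The cyclic shift of the first four coordinates of a point of the cube `B^6`. -/
def rotFour (x : Fin 6 → Bool) : Fin 6 → Bool := ![x 1, x 2, x 3, x 0, x 4, x 5]

/-- The index of the orbit of `(x 0, x 1, x 2, x 3)` under cyclic shifts; the orbits are those of
`0000`, `1000`, `1100`, `1010`, `1110`, `1111`, in this order. -/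
def orbitIndex (x : Fin 6 → Bool) : Fin 6 :=
  match (x 0).toNat + (x 1).toNat + (x 2).toNat + (x 3).toNat with
  | 0 => 0
  | 1 => 1
  | 2 => if x 0 = x 2 then 3 else 2
  | 3 => 4
  | _ => 5

/-- A representative of the orbit with index `j`, with the last two coordinates `a` and `b`. -/
def orbitRep (j : Fin 6) (a b : Bool) : Fin 6 → Bool :=
  ![decide (1 ≤ j), decide (j = 2 ∨ 4 ≤ j), decide (3 ≤ j), decide (5 ≤ j), a, b]

/-- The indicator functions of the eight upper sets of the poset of orbits. -/
def orbitUpperSet (k : Fin 8) (j : Fin 6) : Bool :=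
  match k with
  | 0 => false
  | 1 => decide (5 ≤ j)
  | 2 => decide (4 ≤ j)
  | 3 => decide (j = 2 ∨ 4 ≤ j)
  | 4 => decide (3 ≤ j)
  | 5 => decide (2 ≤ j)
  | 6 => decide (1 ≤ j)
  | 7 => true

/-- Inclusion of upper sets of orbits, in terms of their indices. -/
def UpperSetLE (k l : Fin 8) : Prop := k ≤ l ∧ ¬(k = 3 ∧ l = 4)

instance : DecidableRel UpperSetLE := fun _ _ => inferInstanceAs (Decidable (_ ∧ _))

theorem upperSetLE_iff :
    ∀ k l, UpperSetLE k l ↔ ∀ j, orbitUpperSet k j ≤ orbitUpperSet l j := by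
  decide +kernel

theorem orbitUpperSet_injective : Function.Injective orbitUpperSet := by
  intro k l
  revert k l
  decide +kernel

/-- Four upper sets, indexed by the points `00`, `01`, `10`, `11` of `B^2`, form a monotone
family. -/
def IsMonotoneSquare (q : (Fin 8 × Fin 8) × (Fin 8 × Fin 8)) : Prop :=
  UpperSetLE q.1.1 q.1.2 ∧ UpperSetLE q.1.1 q.2.1 ∧ UpperSetLE q.1.2 q.2.2 ∧ UpperSetLE q.2.1 q.2.2

instance : DecidablePred IsMonotoneSquare := fun _ => inferInstanceAs (Decidable (_ ∧ _))

theorem card_isMonotoneSquare : Fintype.card {q // IsMonotoneSquare q} = 494 := by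
  decide +kernel

/-- The entry of a square at a point of `B^2`. -/
def squareEntry (q : (Fin 8 × Fin 8) × (Fin 8 × Fin 8)) (a b : Bool) : Fin 8 :=
  bif a then (bif b then q.2.2 else q.2.1) else (bif b then q.1.2 else q.1.1)

/-- The Boolean function on `B^6` assembled from four upper sets of orbits. -/
def squareFun (q : (Fin 8 × Fin 8) × (Fin 8 × Fin 8)) (x : Fin 6 → Bool) : Bool :=
  orbitUpperSet (squareEntry q (x 4) (x 5)) (orbitIndex x)

theorem orbitIndex_rotFour : ∀ x, orbitIndex (rotFour x) = orbitIndex x := by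
  decide +kernel

theorem orbitIndex_orbitRep : ∀ j a b, orbitIndex (orbitRep j a b) = j := by
  decide +kernel

theorem exists_iterate_rotFour_eq :
    ∀ x, ∃ n : Fin 4, rotFour^[n] x = orbitRep (orbitIndex x) (x 4) (x 5) := by
  decide +kernel

theorem orbitUpperSet_orbitIndex_mono :
    ∀ k, ∀ x y : Fin 6 → Bool, (∀ i, x i ≤ y i) →
      orbitUpperSet k (orbitIndex x) ≤ orbitUpperSet k (orbitIndex y) := by
  decide +kernel

theorem orbitRep_mono_right (j : Fin 6) {a a' b b' : Bool} (ha : a ≤ a') (hb : b ≤ b') :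
    orbitRep j a b ≤ orbitRep j a' b' := by
  intro i
  fin_cases i <;> simp [orbitRep, ha, hb]

theorem exists_orbitUpperSet_eq :
    ∀ v : Fin 6 → Bool, v 0 ≤ v 1 ∧ v 1 ≤ v 2 ∧ v 1 ≤ v 3 ∧ v 2 ≤ v 4 ∧ v 3 ≤ v 4 ∧ v 4 ≤ v 5 →
      ∃ k, orbitUpperSet k = v := by
  decide +kernel

theorem apply_eq_apply_orbitRep {f : (Fin 6 → Bool) → Bool} (hf : ∀ x, f (rotFour x) = f x)
    (x : Fin 6 → Bool) : f x = f (orbitRep (orbitIndex x) (x 4) (x 5)) := by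
  obtain ⟨n, hn⟩ := exists_iterate_rotFour_eq x
  have iterate_eq : ∀ m : ℕ, f (rotFour^[m] x) = f x := by
    intro m
    induction m with
    | zero => rfl
    | succ m ih => rw [Function.iterate_succ_apply', hf, ih]
  rw [← hn, iterate_eq]

theorem orbitRep_mono_left {i j : Fin 6} (a b : Bool) (hij : i ≤ j) (h : ¬(i = 2 ∧ j = 3)) :
    orbitRep i a b ≤ orbitRep j a b := by
  have pointwise_le : ∀ i j : Fin 6, i ≤ j ∧ ¬(i = 2 ∧ j = 3) → ∀ a b t,
      orbitRep i a b t ≤ orbitRep j a b t := by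
    decide +kernel
  exact pointwise_le i j ⟨hij, h⟩ a b

theorem exists_orbitUpperSet_eq_of_monotone {f : (Fin 6 → Bool) → Bool} (hf : Monotone f)
    (a b : Bool) : ∃ k, ∀ j, orbitUpperSet k j = f (orbitRep j a b) := by
  have f_le {i j : Fin 6} (hij : i ≤ j) (h : ¬(i = 2 ∧ j = 3)) :
      f (orbitRep i a b) ≤ f (orbitRep j a b) :=
    hf (orbitRep_mono_left a b hij h)
  obtain ⟨k, hk⟩ := exists_orbitUpperSet_eq (fun j => f (orbitRep j a b))
    ⟨f_le (by decide) (by decide), f_le (by decide) (by decide), f_le (by decide) (by decide),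
      f_le (by decide) (by decide), f_le (by decide) (by decide), f_le (by decide) (by decide)⟩
  exact ⟨k, congrFun hk⟩

theorem IsMonotoneSquare.squareEntry_le {q : (Fin 8 × Fin 8) × (Fin 8 × Fin 8)}
    (hq : IsMonotoneSquare q) {a a' b b' : Bool} (ha : a ≤ a') (hb : b ≤ b') (j : Fin 6) :
    orbitUpperSet (squareEntry q a b) j ≤ orbitUpperSet (squareEntry q a' b') j := by
  obtain ⟨h1, h2, h3, h4⟩ := hq
  rw [upperSetLE_iff] at h1 h2 h3 h4
  have not_true_le : ¬(true ≤ false) := by decide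
  have h14 := (h1 j).trans (h3 j)
  cases a <;> cases a' <;> cases b <;> cases b' <;> simp_all [squareEntry]

theorem IsMonotoneSquare.monotone_squareFun {q : (Fin 8 × Fin 8) × (Fin 8 × Fin 8)}
    (hq : IsMonotoneSquare q) : Monotone (squareFun q) := fun x y hxy =>
  (hq.squareEntry_le (hxy 4) (hxy 5) _).trans (orbitUpperSet_orbitIndex_mono _ x y hxy)

theorem squareFun_rotFour (q : (Fin 8 × Fin 8) × (Fin 8 × Fin 8)) (x : Fin 6 → Bool) :
    squareFun q (rotFour x) = squareFun q x := by
  simp only [squareFun, orbitIndex_rotFour]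
  rfl

theorem squareFun_orbitRep (q : (Fin 8 × Fin 8) × (Fin 8 × Fin 8)) (j : Fin 6) (a b : Bool) :
    squareFun q (orbitRep j a b) = orbitUpperSet (squareEntry q a b) j := by
  rw [squareFun, orbitIndex_orbitRep]
  rfl

theorem squareFun_injective : Function.Injective squareFun := by
  intro q q' h
  have entry_eq (a b : Bool) : squareEntry q a b = squareEntry q' a b := by
    refine orbitUpperSet_injective (funext fun j => ?_)
    rw [← squareFun_orbitRep, h, squareFun_orbitRep]
  exact Prod.ext (Prod.ext (entry_eq false false) (entry_eq false true))
    (Prod.ext (entry_eq true false) (entry_eq true true))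

theorem exists_squareFun_eq {f : (Fin 6 → Bool) → Bool} (hf : Monotone f)
    (hrot : ∀ x, f (rotFour x) = f x) : ∃ q, IsMonotoneSquare q ∧ squareFun q = f := by
  choose k hk using exists_orbitUpperSet_eq_of_monotone hf
  have k_le {a a' b b' : Bool} (ha : a ≤ a') (hb : b ≤ b') : UpperSetLE (k a b) (k a' b') := by
    rw [upperSetLE_iff]
    intro j
    rw [hk, hk]
    exact hf (orbitRep_mono_right j ha hb)
  refine ⟨((k false false, k false true), (k true false, k true true)),
    ⟨k_le le_rfl (Bool.false_le _), k_le (Bool.false_le _) le_rfl,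
      k_le (Bool.false_le _) le_rfl, k_le le_rfl (Bool.false_le _)⟩, funext fun x => ?_⟩
  rw [apply_eq_apply_orbitRep hrot x, ← hk, squareFun]
  cases x 4 <;> cases x 5 <;> rfl


/-- For the permutation `σ` of `Fin 6` given by the 4-cycle `(0 1 2 3)` fixing `4` and `5`, the number of monotone functions `f : (Fin 6 → Bool) → Bool` with `f (x ∘ σ) = f x` for all `x` equals 494.  In the paper's notation: `|Fix((1234), D_6)| = 494`. -/
theorem fix_card_1234_D6 (σ : Equiv.Perm (Fin 6))
    (h0 : σ 0 = 1) (h1 : σ 1 = 2) (h2 : σ 2 = 3) (h3 : σ 3 = 0) (h4 : σ 4 = 4) (h5 : σ 5 = 5) :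
    Nat.card {f : (Fin 6 → Bool) → Bool //
        Monotone f ∧ ∀ x : Fin 6 → Bool, f (x ∘ ⇑σ) = f x} = 494 := by
  have comp_eq (x : Fin 6 → Bool) : x ∘ ⇑σ = rotFour x := by
    funext i
    fin_cases i <;> simp [rotFour, h0, h1, h2, h3, h4, h5]
  simp only [comp_eq]
  rw [← card_isMonotoneSquare, ← Nat.card_eq_fintype_card]
  refine (Nat.card_congr (Equiv.ofBijective
    (fun q => ⟨squareFun q.1, q.2.monotone_squareFun, squareFun_rotFour q.1⟩) ⟨?_, ?_⟩)).symm
  · intro q q' h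
    exact Subtype.ext (squareFun_injective (congrArg Subtype.val h))
  · rintro ⟨f, hf, hrot⟩
    obtain ⟨q, hq, rfl⟩ := exists_squareFun_eq hf hrot
    exact ⟨⟨q, hq⟩, rfl⟩
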